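/- Let (T(t))_{t>0} be an injective and contractive *-semigroup on L∞(E,m) such that every operator T(t) is a positive strong Feller operator. If (t_n) ⊂ (0,∞) converges to t > 0 and f ∈ L∞(E,m), then T(t_n)f → T(t)f uniformly on compact subsets of E (where images are identified with their continuous representatives). -/

import Mathlib

open MeasureTheory Filter Topology

variable {E : Type*}

/-- The weak* topology `σ(L∞, L¹)` on `L∞(E, m)`, induced by the pairings
`f ↦ ∫ f g dm`, `g ∈ L¹(E, m)`. -/
noncomputable def weakStarLinf [MeasurableSpace E] (m : MeasureTheory.Measure E) :
    TopologicalSpace (MeasureTheory.Lp ℝ ⊤ m) :=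
  TopologicalSpace.induced
    (fun (f : MeasureTheory.Lp ℝ ⊤ m) (g : MeasureTheory.Lp ℝ 1 m) =>
      ∫ x, (f : E → ℝ) x * (g : E → ℝ) x ∂m) inferInstance

theorem ae_norm_le_norm_Linf {α : Type*} [MeasurableSpace α] {μ : Measure α} (f : Lp ℝ ⊤ μ) :
    ∀ᵐ x ∂μ, ‖f x‖ ≤ ‖f‖ := by
  filter_upwards [ae_le_eLpNormEssSup (f := (f : α → ℝ)) (μ := μ)] with x hx
  rw [Lp.norm_def, eLpNorm_exponent_top, ← toReal_enorm]
  refine ENNReal.toReal_mono ?_ hx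
  rw [← eLpNorm_exponent_top]
  exact Lp.eLpNorm_ne_top f

theorem norm_Linf_le_of_ae_bound {α : Type*} [MeasurableSpace α] {μ : Measure α} {f : Lp ℝ ⊤ μ}
    {C : ℝ} (hC : 0 ≤ C) (hf : ∀ᵐ x ∂μ, ‖f x‖ ≤ C) : ‖f‖ ≤ C := by
  rw [Lp.norm_def, eLpNorm_exponent_top]
  exact ENNReal.toReal_le_of_le_ofReal hC (eLpNormEssSup_le_of_ae_bound hf)

theorem memLp_top_indicator_one {α : Type*} [MeasurableSpace α] (μ : Measure α) {s : Set α}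
    (hs : MeasurableSet s) : MemLp (s.indicator fun _ => (1 : ℝ)) ⊤ μ :=
  memLp_top_of_bound (measurable_const.indicator hs).aestronglyMeasurable 1
    (Eventually.of_forall fun x => by by_cases hx : x ∈ s <;> simp [hx])

/-- A linear functional on `L∞` that is sequentially continuous along bounded almost everywhere
convergent sequences is represented by an integrable function. -/
theorem exists_integrable_density_of_bounded_ae_continuous {α : Type*} [MeasurableSpace α]
    {μ : Measure α} [SigmaFinite μ] (φ : Lp ℝ ⊤ μ →ₗ[ℝ] ℝ)
    (hφ : ∀ (fs : ℕ → Lp ℝ ⊤ μ) (f : Lp ℝ ⊤ μ), (∃ C : ℝ, ∀ n, ‖fs n‖ ≤ C) →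
      (∀ᵐ x ∂μ, Tendsto (fun n => fs n x) atTop (𝓝 (f x))) →
      Tendsto (fun n => φ (fs n)) atTop (𝓝 (φ f))) :
    ∃ g : α → ℝ, Integrable g μ ∧ ∀ f : Lp ℝ ⊤ μ, φ f = ∫ x, f x * g x ∂μ := by
  classical
  let ν : SignedMeasure α :=
    { measureOf' := fun s => if hs : MeasurableSet s then
        φ ((memLp_top_indicator_one μ hs).toLp _) else 0
      empty' := by
        rw [dif_pos MeasurableSet.empty, ← map_zero φ]
        congr 1
        ext1
        filter_upwards [MemLp.coeFn_toLp (memLp_top_indicator_one μ MeasurableSet.empty),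
          Lp.coeFn_zero ℝ ⊤ μ] with x h1 h2
        rw [h1, h2]; simp
      not_measurable' := fun s hs => dif_neg hs
      m_iUnion' := by
        intro A hA hd
        simp only [hA, MeasurableSet.iUnion hA, dif_pos]
        refine tendsto_of_seq_tendsto fun u hu => ?_
        have hu' : Tendsto u atTop atTop := by simpa using hu
        simp only [← map_sum]
        have hsum : ∀ S : Finset ℕ, (∑ i ∈ S, (memLp_top_indicator_one μ (hA i)).toLp _ : Lp ℝ ⊤ μ)
            = (memLp_top_indicator_one μ (S.measurableSet_biUnion fun i _ => hA i)).toLp _ := by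
          intro S
          ext1
          have h1 := Lp.coeFn_finsetSum S
            (fun i => (memLp_top_indicator_one μ (hA i)).toLp _)
          have h2 : ∀ᵐ x ∂μ, ∀ i, (memLp_top_indicator_one μ (hA i)).toLp _ x =
              (A i).indicator (fun _ => (1 : ℝ)) x :=
            ae_all_iff.2 fun i => MemLp.coeFn_toLp (memLp_top_indicator_one μ (hA i))
          filter_upwards [h1, h2, MemLp.coeFn_toLp (memLp_top_indicator_one μ
            (S.measurableSet_biUnion fun i _ => hA i))] with x h1 h2 h3
          rw [h1, h3, Finset.sum_apply, Finset.indicator_biUnion _ _ (fun i _ j _ hij => hd hij)]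
          exact Finset.sum_congr rfl fun i _ => h2 i
        simp only [hsum]
        refine hφ _ _ ⟨1, fun n => norm_Linf_le_of_ae_bound zero_le_one ?_⟩ ?_
        · filter_upwards [MemLp.coeFn_toLp (memLp_top_indicator_one μ
            ((u n).measurableSet_biUnion fun i _ => hA i))] with x hx
          rw [hx]
          exact (norm_indicator_le_norm_self _ _).trans (by simp)
        · have h2 : ∀ᵐ x ∂μ, ∀ n, (memLp_top_indicator_one μ
              ((u n).measurableSet_biUnion fun i _ => hA i)).toLp _ x =
              (⋃ i ∈ u n, A i).indicator (fun _ => (1 : ℝ)) x :=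
            ae_all_iff.2 fun n => MemLp.coeFn_toLp _
          filter_upwards [h2, MemLp.coeFn_toLp (memLp_top_indicator_one μ
            (MeasurableSet.iUnion hA))] with x h2 h3
          simp only [h2, h3]
          exact (tendsto_indicator_biUnion_finset A (fun _ => (1 : ℝ)) x).mono_right
            (pure_le_nhds _) |>.comp hu' }
  have hν : ∀ s (hs : MeasurableSet s), ν s = φ ((memLp_top_indicator_one μ hs).toLp _) :=
    fun s hs => dif_pos hs
  have hac : ν ≪ᵥ μ.toENNRealVectorMeasure := by
    refine VectorMeasure.AbsolutelyContinuous.mk fun s hs h0 => ?_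
    rw [Measure.toENNRealVectorMeasure_apply_measurable hs] at h0
    rw [hν s hs, ← map_zero φ]
    congr 1
    ext1
    filter_upwards [MemLp.coeFn_toLp (memLp_top_indicator_one μ hs),
      Lp.coeFn_zero ℝ ⊤ μ, measure_eq_zero_iff_ae_notMem.1 h0] with x h1 h2 h3
    rw [h1, h2]; simp [h3]
  have hg := SignedMeasure.integrable_rnDeriv ν μ
  set g := ν.rnDeriv μ
  have hind : ∀ s (hs : MeasurableSet s),
      φ ((memLp_top_indicator_one μ hs).toLp _) = ∫ x in s, g x ∂μ := by
    intro s hs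
    rw [← hν s hs, ← withDensityᵥ_apply hg hs, SignedMeasure.withDensityᵥ_rnDeriv_eq _ _ hac]
  have hsimple : ∀ f : SimpleFunc α ℝ, ∀ F : Lp ℝ ⊤ μ, F =ᵐ[μ] f →
      φ F = ∫ x, f x * g x ∂μ := by
    intro f
    induction f using SimpleFunc.induction with
    | const c hs =>
      rename_i s
      intro F hF
      have : F = c • (memLp_top_indicator_one μ hs).toLp _ := by
        ext1
        filter_upwards [hF, Lp.coeFn_smul c ((memLp_top_indicator_one μ hs).toLp _),
          MemLp.coeFn_toLp (memLp_top_indicator_one μ hs)] with x h1 h2 h3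
        rw [h1, h2, Pi.smul_apply, h3]
        by_cases hx : x ∈ s <;> simp [hx]
      rw [this, map_smul, hind s hs, smul_eq_mul, ← integral_const_mul, ← integral_indicator hs]
      congr 1
      ext x
      by_cases hx : x ∈ s <;> simp [hx]
    | add _ h₁ h₂ =>
      rename_i f₁ f₂ _
      intro F hF
      have hm : ∀ f : SimpleFunc α ℝ, MemLp f ⊤ μ := fun f => f.memLp_top μ
      have : F = (hm f₁).toLp _ + (hm f₂).toLp _ := by
        ext1
        filter_upwards [hF, Lp.coeFn_add ((hm f₁).toLp _) ((hm f₂).toLp _),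
          (hm f₁).coeFn_toLp, (hm f₂).coeFn_toLp] with x h1 h2 h3 h4
        rw [h1, h2, Pi.add_apply, h3, h4]; rfl
      have hi : ∀ f : SimpleFunc α ℝ, Integrable (fun x => f x * g x) μ := fun f => by
        obtain ⟨C, hC⟩ := f.exists_forall_norm_le
        exact hg.bdd_mul f.aestronglyMeasurable (Eventually.of_forall hC)
      rw [this, map_add, h₁ _ (hm f₁).coeFn_toLp, h₂ _ (hm f₂).coeFn_toLp,
        ← integral_add (hi f₁) (hi f₂)]
      congr 1
      ext x
      simp [add_mul]
  refine ⟨g, hg, fun f => ?_⟩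
  have hfm := Lp.stronglyMeasurable f
  let fs := hfm.approxBounded ‖f‖
  have hlim : ∀ᵐ x ∂μ, Tendsto (fun n => fs n x) atTop (𝓝 (f x)) :=
    hfm.tendsto_approxBounded_ae (ae_norm_le_norm_Linf f)
  have hb : ∀ n x, ‖fs n x‖ ≤ ‖f‖ := hfm.norm_approxBounded_le (norm_nonneg _)
  have h1 : Tendsto (fun n => φ (((fs n).memLp_top μ).toLp _)) atTop (𝓝 (φ f)) := by
    have h2 : ∀ᵐ x ∂μ, ∀ n, ((fs n).memLp_top μ).toLp _ x = fs n x :=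
      ae_all_iff.2 fun n => MemLp.coeFn_toLp _
    refine hφ _ _ ⟨‖f‖, fun n => norm_Linf_le_of_ae_bound (norm_nonneg _) ?_⟩ ?_
    · filter_upwards [h2] with x h2
      rw [h2]; exact hb n x
    · filter_upwards [h2, hlim] with x h2 h3
      simpa only [h2] using h3
  refine tendsto_nhds_unique h1 ?_
  simp only [fun n => hsimple (fs n) _ ((fs n).memLp_top μ).coeFn_toLp]
  refine tendsto_integral_of_dominated_convergence (fun x => ‖f‖ * ‖g x‖)
    (fun n => (fs n).aestronglyMeasurable.mul hg.1) (hg.norm.const_mul _) (fun n => ?_) ?_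
  · refine Eventually.of_forall fun x => ?_
    rw [norm_mul]
    exact mul_le_mul_of_nonneg_right (hb n x) (norm_nonneg _)
  · filter_upwards [hlim] with x hx using hx.mul_const _

/-- **Pettis measurability** for maps into a separable normed space, tested on a norming set of
functionals. -/
theorem measurable_of_norming {α X : Type*} [MeasurableSpace α] [NormedAddCommGroup X]
    [NormedSpace ℝ X] [SecondCountableTopology X] [MeasurableSpace X] [BorelSpace X]
    (Φ : Set (X →L[ℝ] ℝ)) (hΦ : ∀ y : X, ∃ φ ∈ Φ, ‖φ‖ ≤ 1 ∧ φ y = ‖y‖)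
    {u : α → X} (hu : ∀ φ ∈ Φ, Measurable fun a => φ (u a)) : Measurable u := by
  choose ψ hψ hψ1 hψy using hΦ
  let d := TopologicalSpace.denseSeq X
  have hd : DenseRange d := TopologicalSpace.denseRange_denseSeq X
  have key : ∀ (z : X) (r : ℝ), ‖z‖ ≤ r ↔ ∀ n, ψ (d n) z ≤ r := by
    intro z r
    constructor
    · intro h n
      calc ψ (d n) z ≤ ‖ψ (d n) z‖ := le_abs_self _
        _ ≤ ‖ψ (d n)‖ * ‖z‖ := (ψ (d n)).le_opNorm z
        _ ≤ 1 * ‖z‖ := by gcongr; exact hψ1 _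
        _ ≤ r := by simpa using h
    · intro h
      refine le_of_forall_pos_le_add fun ε hε => ?_
      obtain ⟨n, hn⟩ := hd.exists_dist_lt z (half_pos hε)
      rw [dist_eq_norm] at hn
      have h1 : ‖d n‖ ≤ ψ (d n) z + ‖z - d n‖ := by
        have : ψ (d n) (d n - z) ≤ ‖z - d n‖ := by
          calc ψ (d n) (d n - z) ≤ ‖ψ (d n) (d n - z)‖ := le_abs_self _
            _ ≤ ‖ψ (d n)‖ * ‖d n - z‖ := (ψ (d n)).le_opNorm _
            _ ≤ 1 * ‖d n - z‖ := by gcongr; exact hψ1 _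
            _ = ‖z - d n‖ := by rw [one_mul, norm_sub_rev]
        rw [map_sub, hψy] at this
        linarith
      have h2 : ‖z‖ ≤ ‖d n‖ + ‖z - d n‖ := by
        simpa using norm_add_le (d n) (z - d n)
      linarith [h n]
  have hball : ∀ (y : X) (r : ℝ), MeasurableSet (u ⁻¹' Metric.closedBall y r) := by
    intro y r
    have : u ⁻¹' Metric.closedBall y r = ⋂ n, {a | ψ (d n) (u a) - ψ (d n) y ≤ r} := by
      ext a
      simp only [Set.mem_preimage, Metric.mem_closedBall, dist_eq_norm, Set.mem_iInter,
        Set.mem_ofPred_eq, key, map_sub]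
    rw [this]
    exact MeasurableSet.iInter fun n =>
      measurableSet_le ((hu _ (hψ _)).sub_const _) measurable_const
  refine measurable_of_isOpen fun U hU => ?_
  have : u ⁻¹' U = ⋃ (p : ℕ × ℕ) (_ : Metric.closedBall (d p.1) (1 / (p.2 + 1)) ⊆ U),
      u ⁻¹' Metric.closedBall (d p.1) (1 / (p.2 + 1)) := by
    ext a
    simp only [Set.mem_preimage, Set.mem_iUnion, exists_prop]
    constructor
    · intro ha
      obtain ⟨ε, hε, hεU⟩ := Metric.isOpen_iff.1 hU _ ha
      obtain ⟨k, hk⟩ := exists_nat_one_div_lt (half_pos hε)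
      obtain ⟨n, hn⟩ := hd.exists_dist_lt (u a) (Nat.one_div_pos_of_nat (α := ℝ) (n := k))
      refine ⟨(n, k), fun z hz => hεU ?_, hn.le⟩
      rw [Metric.mem_closedBall] at hz
      rw [Metric.mem_ball]
      have := dist_triangle z (d n) (u a)
      rw [dist_comm (d n)] at this
      simp only at hz
      linarith
    · rintro ⟨p, hp, ha⟩
      exact hp ha
  rw [this]
  exact MeasurableSet.iUnion fun p => MeasurableSet.iUnion fun _ => hball _ _

/-- A bounded, measurable curve on `(0, ∞)` whose increments contract under translation to the
right is continuous. -/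
theorem continuousAt_of_measurable_of_contracting_translates {X : Type*} [NormedAddCommGroup X]
    {v : ℝ → X} {M : ℝ} (hb : ∀ t, 0 < t → ‖v t‖ ≤ M)
    (hv : ∀ r, 0 < r → AEStronglyMeasurable v (volume.restrict (Set.Ioi r)))
    (hc : ∀ a b s, 0 < a → 0 < b → 0 < s → ‖v (a + s) - v (b + s)‖ ≤ ‖v a - v b‖)
    {t : ℝ} (ht : 0 < t) : ContinuousAt v t := by
  let J : Set ℝ := Set.Ioo (t / 4) (2 * t)
  have hw : MemLp (J.indicator v) 1 volume := by
    rw [memLp_indicator_iff_restrict measurableSet_Ioo]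
    have : IsFiniteMeasure (volume.restrict J) := ⟨by simp [J]⟩
    refine MemLp.of_bound ((hv (t / 4) (by positivity)).mono_set Set.Ioo_subset_Ioi_self) M ?_
    refine (ae_restrict_iff' measurableSet_Ioo).2 (Eventually.of_forall fun x hx => hb x ?_)
    exact lt_trans (by positivity) hx.1
  let W : Lp X 1 (volume : Measure ℝ) := hw.toLp _
  have : Fact ((1 : ENNReal) ≠ ⊤) := ⟨ENNReal.one_ne_top⟩
  have hcont : Tendsto (fun c : ℝ => ‖(DomAddAct.mk c +ᵥ W) - W‖) (𝓝 0) (𝓝 0) := by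
    have h1 : Continuous fun c : ℝ => ‖(DomAddAct.mk c +ᵥ W) - W‖ := by
      have : Continuous fun c : ℝ => DomAddAct.mk c +ᵥ W := by
        have h2 : Continuous (DomAddAct.mk : ℝ → ℝᵈᵃᵃ) := DomAddAct.continuous_mk
        exact h2.vadd continuous_const
      exact (this.sub continuous_const).norm
    have := h1.tendsto 0
    simpa using this
  have hint : ∀ c : ℝ, Integrable (fun y => ‖J.indicator v (c + y) - J.indicator v y‖) volume ∧
      ‖(DomAddAct.mk c +ᵥ W) - W‖ = ∫ y, ‖J.indicator v (c + y) - J.indicator v y‖ := by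
    intro c
    have hae : (((DomAddAct.mk c +ᵥ W) - W : Lp X 1 (volume : Measure ℝ)) : ℝ → X) =ᵐ[volume]
        fun y => J.indicator v (c + y) - J.indicator v y := by
      have h1 : (DomAddAct.mk c +ᵥ W : Lp X 1 (volume : Measure ℝ)) =
          (hw.comp_measurePreserving (measurePreserving_vadd c volume)).toLp _ := rfl
      rw [h1]
      filter_upwards [Lp.coeFn_sub ((hw.comp_measurePreserving
        (measurePreserving_vadd c volume)).toLp _) W, hw.coeFn_toLp,
        (hw.comp_measurePreserving (measurePreserving_vadd c volume)).coeFn_toLp] with y h1 h2 h3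
      rw [h1, Pi.sub_apply, h2, h3]
      rfl
    constructor
    · exact ((L1.integrable_coeFn _).congr hae).norm
    · rw [L1.norm_eq_integral_norm]
      exact integral_congr_ae (hae.mono fun y hy => congrArg norm hy)
  have hle : ∀ᶠ c in 𝓝 (0 : ℝ), ‖v (t + c) - v t‖ ≤ 2 / t * ‖(DomAddAct.mk c +ᵥ W) - W‖ := by
    filter_upwards [Metric.ball_mem_nhds (0 : ℝ) (show 0 < t / 8 by positivity)] with c hc0
    rw [Metric.mem_ball, dist_zero_right, Real.norm_eq_abs, abs_lt] at hc0
    obtain ⟨hi, hn⟩ := hint c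
    have h1 : ∫ y in Set.Ioo (t / 2) t, ‖v (t + c) - v t‖ ≤
        ∫ y in Set.Ioo (t / 2) t, ‖J.indicator v (c + y) - J.indicator v y‖ := by
      refine setIntegral_mono_on (integrableOn_const (by simp)) hi.integrableOn
        measurableSet_Ioo fun y hy => ?_
      have hyJ : y ∈ J := ⟨by linarith [hy.1], by linarith [hy.2]⟩
      have hcyJ : c + y ∈ J := ⟨by linarith [hy.1], by linarith [hy.2]⟩
      rw [Set.indicator_of_mem hyJ, Set.indicator_of_mem hcyJ]
      have := hc (c + y) y (t - y) (by linarith [hy.1]) (by linarith [hy.1]) (by linarith [hy.2])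
      rwa [show c + y + (t - y) = t + c by ring, show y + (t - y) = t by ring] at this
    have h2 : ∫ y in Set.Ioo (t / 2) t, ‖J.indicator v (c + y) - J.indicator v y‖ ≤
        ∫ y, ‖J.indicator v (c + y) - J.indicator v y‖ :=
      setIntegral_le_integral hi (Eventually.of_forall fun _ => norm_nonneg _)
    rw [setIntegral_const, smul_eq_mul, Real.volume_real_Ioo_of_le (by linarith)] at h1
    rw [hn]
    have h3 := h1.trans h2
    rw [div_mul_eq_mul_div, le_div_iff₀ ht]
    linarith
  have hlim : Tendsto (fun c => v (t + c)) (𝓝 0) (𝓝 (v t)) := by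
    rw [tendsto_iff_norm_sub_tendsto_zero]
    refine squeeze_zero' (Eventually.of_forall fun _ => norm_nonneg _) hle ?_
    simpa using hcont.const_mul (2 / t)
  have hsub : Tendsto (fun s => s - t) (𝓝 t) (𝓝 0) := by
    have : Continuous fun s : ℝ => s - t := by fun_prop
    simpa using this.tendsto t
  have := hlim.comp hsub
  simpa [ContinuousAt, Function.comp_def] using this

/-- The duality pairing `(f, g) ↦ ∫ f g` between `L∞` and `L¹`. -/
noncomputable def pairingLinfL1 {α : Type*} [MeasurableSpace α] (μ : Measure α) :
    Lp ℝ ⊤ μ →L[ℝ] Lp ℝ 1 μ →L[ℝ] ℝ :=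
  (ContinuousLinearMap.mul ℝ ℝ).lpPairing μ ⊤ 1

theorem pairingLinfL1_apply {α : Type*} [MeasurableSpace α] {μ : Measure α} (f : Lp ℝ ⊤ μ)
    (g : Lp ℝ 1 μ) : pairingLinfL1 μ f g = ∫ x, f x * g x ∂μ :=
  ContinuousLinearMap.lpPairing_eq_integral ..

theorem norm_pairingLinfL1_apply_le {α : Type*} [MeasurableSpace α] {μ : Measure α}
    (f : Lp ℝ ⊤ μ) : ‖pairingLinfL1 μ f‖ ≤ ‖f‖ := by
  refine ContinuousLinearMap.opNorm_le_bound _ (norm_nonneg _) fun g => ?_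
  rw [pairingLinfL1_apply, L1.norm_eq_integral_norm, ← integral_const_mul]
  refine norm_integral_le_of_norm_le ((L1.integrable_coeFn g).norm.const_mul _) ?_
  filter_upwards [ae_norm_le_norm_Linf f] with x hx
  rw [norm_mul]
  exact mul_le_mul_of_nonneg_right hx (norm_nonneg _)

theorem exists_pairingLinfL1_eq_norm {α : Type*} [MeasurableSpace α] {μ : Measure α}
    (g : Lp ℝ 1 μ) : ∃ f : Lp ℝ ⊤ μ, ‖f‖ ≤ 1 ∧ pairingLinfL1 μ f g = ‖g‖ := by
  let s : α → ℝ := fun x => if 0 ≤ g x then 1 else -1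
  have hs : Measurable s :=
    Measurable.ite (measurableSet_le measurable_const (Lp.stronglyMeasurable g).measurable)
      measurable_const measurable_const
  have hs1 : ∀ x, ‖s x‖ ≤ 1 := fun x => by
    simp only [s]; split_ifs <;> simp
  have hm : MemLp s ⊤ μ :=
    memLp_top_of_bound hs.aestronglyMeasurable 1 (Eventually.of_forall hs1)
  refine ⟨hm.toLp s, norm_Linf_le_of_ae_bound zero_le_one ?_, ?_⟩
  · filter_upwards [hm.coeFn_toLp] with x hx
    rw [hx]; exact hs1 x
  · rw [pairingLinfL1_apply, L1.norm_eq_integral_norm]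
    refine integral_congr_ae ?_
    filter_upwards [hm.coeFn_toLp] with x hx
    simp only [hx, s, Real.norm_eq_abs]
    split_ifs with h
    · rw [one_mul, abs_of_nonneg h]
    · rw [neg_one_mul, abs_of_neg (not_le.1 h)]

/-- Densities in `L¹` of the orbit of a functional under a weakly measurable contraction semigroup
on `L∞` depend continuously on time. -/
theorem continuousAt_density_of_semigroup {α : Type*} [MeasurableSpace α]
    [MeasurableSpace.CountablyGenerated α] {μ : Measure α} [SigmaFinite μ]
    {T : ℝ → Lp ℝ ⊤ μ →L[ℝ] Lp ℝ ⊤ μ}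
    (hmeas : ∀ (f : Lp ℝ ⊤ μ) (g : Lp ℝ 1 μ), Measurable ((Set.Ioi (0 : ℝ)).domRestrict
      fun t => pairingLinfL1 μ (T t f) g))
    (hcontr : ∀ t, 0 < t → ‖T t‖ ≤ 1) {v : ℝ → Lp ℝ 1 μ} {M : ℝ} (hv : ∀ t, 0 < t → ‖v t‖ ≤ M)
    (hsg : ∀ t s, 0 < t → 0 < s → ∀ f,
      pairingLinfL1 μ f (v (t + s)) = pairingLinfL1 μ (T s f) (v t))
    {t : ℝ} (ht : 0 < t) : ContinuousAt v t := by
  have : Fact ((1 : ENNReal) ≠ ⊤) := ⟨ENNReal.one_ne_top⟩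
  refine continuousAt_of_measurable_of_contracting_translates hv (fun r hr => ?_)
    (fun a b s ha hb hs => ?_) ht
  · rw [← aestronglyMeasurable_indicator_iff measurableSet_Ioi]
    borelize ↥(Lp ℝ 1 μ)
    refine Measurable.aestronglyMeasurable ?_
    refine measurable_of_norming {φ | ∃ f, φ = pairingLinfL1 μ f ∧ ‖f‖ ≤ 1} (fun y => ?_) ?_
    · obtain ⟨f, hf, hfy⟩ := exists_pairingLinfL1_eq_norm y
      exact ⟨_, ⟨f, rfl, hf⟩, (norm_pairingLinfL1_apply_le f).trans hf, hfy⟩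
    · rintro _ ⟨f, rfl, -⟩
      have hF : Measurable ((Set.Ioi (0 : ℝ)).indicator
          fun t => pairingLinfL1 μ (T t f) (v r)) := by
        refine measurable_of_restrict_of_restrict_compl (s := Set.Ioi 0) measurableSet_Ioi ?_ ?_
        · convert! hmeas f (v r) using 1
          ext a
          exact Set.indicator_of_mem a.2 _
        · convert! measurable_const (a := (0 : ℝ)) using 1
          ext a
          exact Set.indicator_of_notMem a.2 _
      convert! hF.comp (measurable_id.sub_const r) using 1
      ext a
      by_cases ha : r < a
      · have ha' : 0 < a - r := sub_pos.2 ha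
        have := hsg r (a - r) hr ha' f
        rw [add_sub_cancel] at this
        simp [ha, this]
      · simp [ha]
  · obtain ⟨f, hf, hfy⟩ := exists_pairingLinfL1_eq_norm (v (a + s) - v (b + s))
    rw [← hfy, map_sub, hsg a s ha hs, hsg b s hb hs, ← map_sub]
    calc pairingLinfL1 μ (T s f) (v a - v b) ≤ ‖pairingLinfL1 μ (T s f) (v a - v b)‖ :=
          le_abs_self _
      _ ≤ ‖pairingLinfL1 μ (T s f)‖ * ‖v a - v b‖ := ContinuousLinearMap.le_opNorm _ _
      _ ≤ 1 * ‖v a - v b‖ := by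
        gcongr
        calc _ ≤ ‖T s f‖ := norm_pairingLinfL1_apply_le _
          _ ≤ ‖T s‖ * ‖f‖ := (T s).le_opNorm f
          _ ≤ 1 * 1 := by gcongr; exact hcontr s hs
          _ = 1 := one_mul 1
      _ = ‖v a - v b‖ := one_mul _

/-- A positive strong Feller operator maps bounded pointwise null sequences to sequences converging
to zero uniformly on compact sets. -/
theorem tendstoUniformlyOn_of_positive_strongFeller {X : Type*} [TopologicalSpace X]
    [MeasurableSpace X] {μ : Measure X} (S : Lp ℝ ⊤ μ →ₗ[ℝ] BoundedContinuousFunction X ℝ)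
    (hpos : ∀ f : Lp ℝ ⊤ μ, 0 ≤ᵐ[μ] f → ∀ x, 0 ≤ S f x)
    (hS : ∀ (fs : ℕ → Lp ℝ ⊤ μ) (f : Lp ℝ ⊤ μ), (∃ C : ℝ, ∀ n, ‖fs n‖ ≤ C) →
      (∀ᵐ x ∂μ, Tendsto (fun n => fs n x) atTop (𝓝 (f x))) →
      ∀ x, Tendsto (fun n => S (fs n) x) atTop (𝓝 (S f x)))
    {F : ℕ → Lp ℝ ⊤ μ} {G : ℕ → X → ℝ} (hFG : ∀ n, F n =ᵐ[μ] G n)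
    (hG : ∀ n, Measurable (G n)) {C : ℝ} (hC : ∀ n x, |G n x| ≤ C)
    (hlim : ∀ x, Tendsto (fun n => G n x) atTop (𝓝 0)) {K : Set X} (hK : IsCompact K) :
    TendstoUniformlyOn (fun n x => S (F n) x) (fun _ => 0) atTop K := by
  let h : ℕ → X → ℝ := fun n x => ⨆ k, |G (n + k) x|
  have hbdd : ∀ n x, BddAbove (Set.range fun k => |G (n + k) x|) := fun n x =>
    ⟨C, by rintro _ ⟨k, rfl⟩; exact hC _ _⟩
  have hle : ∀ n k x, |G (n + k) x| ≤ h n x := fun n k x => le_ciSup (hbdd n x) k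
  have h0 : ∀ n x, 0 ≤ h n x := fun n x => (abs_nonneg _).trans (hle n 0 x)
  have hhC : ∀ n x, ‖h n x‖ ≤ C := fun n x => by
    rw [Real.norm_eq_abs, abs_of_nonneg (h0 n x)]
    exact ciSup_le fun k => hC _ _
  have hhm : ∀ n, MemLp (h n) ⊤ μ := fun n =>
    memLp_top_of_bound (Measurable.iSup fun k => (hG (n + k)).abs).aestronglyMeasurable C
      (Eventually.of_forall (hhC n))
  have hanti : ∀ x, Antitone fun n => h n x := fun x i j hij => by
    refine ciSup_le fun k => ?_
    have := hle i (j - i + k) x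
    rwa [show i + (j - i + k) = j + k by omega] at this
  have hh : ∀ x, Tendsto (fun n => h n x) atTop (𝓝 0) := fun x => by
    rw [Metric.tendsto_atTop]
    intro ε hε
    obtain ⟨N, hN⟩ := Metric.tendsto_atTop.1 (hlim x) (ε / 2) (half_pos hε)
    refine ⟨N, fun n hn => ?_⟩
    rw [dist_zero_right, Real.norm_eq_abs, abs_of_nonneg (h0 n x)]
    refine lt_of_le_of_lt (ciSup_le fun k => ?_) (half_lt_self hε)
    have := hN (n + k) (by omega)
    rw [dist_zero_right] at this
    exact this.le
  let H : ℕ → Lp ℝ ⊤ μ := fun n => (hhm n).toLp _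
  have hH : ∀ n, H n =ᵐ[μ] h n := fun n => (hhm n).coeFn_toLp
  have hmono : ∀ f g : Lp ℝ ⊤ μ, f ≤ᵐ[μ] g → ∀ x, S f x ≤ S g x := fun f g hfg x => by
    have := hpos (g - f) (by
      filter_upwards [hfg, Lp.coeFn_sub g f] with y h1 h2
      rw [h2]
      exact sub_nonneg.2 h1) x
    rw [map_sub] at this
    exact sub_nonneg.1 this
  have hdini : TendstoUniformlyOn (fun n x => S (H n) x) (fun _ => 0) atTop K := by
    refine Antitone.tendstoUniformlyOn_of_forall_tendsto hK
      (fun n => (S (H n)).continuous.continuousOn) (fun x _ i j hij => ?_) continuousOn_const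
      fun x _ => ?_
    · refine hmono _ _ ?_ x
      filter_upwards [hH i, hH j] with y h1 h2
      rw [h1, h2]
      exact hanti y hij
    · have h1 : ∀ᵐ y ∂μ, ∀ n, H n y = h n y := ae_all_iff.2 hH
      have := hS H 0 ⟨max C 0, fun n => norm_Linf_le_of_ae_bound (le_max_right _ _) ?_⟩ ?_ x
      · simpa using this
      · filter_upwards [hH n] with y hy
        rw [hy]
        exact (hhC n y).trans (le_max_left _ _)
      · filter_upwards [h1, Lp.coeFn_zero ℝ ⊤ μ] with y h1 h2
        simpa only [h1, h2, Pi.zero_apply] using hh y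
  rw [Metric.tendstoUniformlyOn_iff] at hdini ⊢
  intro ε hε
  filter_upwards [hdini ε hε] with n hn x hx
  refine lt_of_le_of_lt ?_ (hn x hx)
  rw [dist_zero_left, dist_zero_left, Real.norm_eq_abs, Real.norm_eq_abs]
  refine (abs_le.2 ⟨?_, ?_⟩).trans (le_abs_self _)
  · have := hmono (-H n) (F n) (by
      filter_upwards [hFG n, hH n, Lp.coeFn_neg (H n)] with y h1 h2 h3
      rw [h1, h3, Pi.neg_apply, h2]
      exact (abs_le.1 (hle n 0 y)).1) x
    simpa using this
  · refine hmono _ _ ?_ x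
    filter_upwards [hFG n, hH n] with y h1 h2
    rw [h1, h2]
    exact (abs_le.1 (hle n 0 y)).2

/-- Let `E` be Polish and `m` a σ-finite Borel measure with full support.
Let `(T(t))_{t>0}` be an injective and contractive `*`-semigroup on `L∞(E, m)` such that
every `T(t)` (`t > 0`) is a positive strong Feller operator, with continuous representatives
`Tc t f`. If `(tₙ) ⊂ (0, ∞)` converges to `t > 0` and `f ∈ L∞(E, m)`, then
`T(tₙ) f → T(t) f` uniformly on compact subsets of `E`. -/
theorem strongFellerSemigroup_locallyUniform_continuity
    [MetricSpace E] [CompleteSpace E] [TopologicalSpace.SeparableSpace E]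
    [MeasurableSpace E] [BorelSpace E]
    (m : MeasureTheory.Measure E) [MeasureTheory.SigmaFinite m]
    (hfull : ∀ (x : E) (r : ℝ), 0 < r → 0 < m (Metric.ball x r))
    (T : ℝ → MeasureTheory.Lp ℝ ⊤ m →L[ℝ] MeasureTheory.Lp ℝ ⊤ m)
    (hw : ∀ t : ℝ, 0 < t → @Continuous _ _ (weakStarLinf m) (weakStarLinf m) (T t))
    (hsg : ∀ t s : ℝ, 0 < t → 0 < s → T (t + s) = (T t).comp (T s))
    (hmeas : ∀ (f : MeasureTheory.Lp ℝ ⊤ m) (g : MeasureTheory.Lp ℝ 1 m),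
      Measurable ((Set.Ioi (0:ℝ)).restrict
        fun t => ∫ x, (T t f : E → ℝ) x * (g : E → ℝ) x ∂m))
    (hcontr : ∀ t : ℝ, 0 < t → ‖T t‖ ≤ 1)
    (hinj : ∀ f : MeasureTheory.Lp ℝ ⊤ m, (∀ t : ℝ, 0 < t → T t f = 0) → f = 0)
    (hpos : ∀ t : ℝ, 0 < t → ∀ f : MeasureTheory.Lp ℝ ⊤ m,
      (0 ≤ᵐ[m] (f : E → ℝ)) → 0 ≤ᵐ[m] (T t f : E → ℝ))
    (Tc : ℝ → MeasureTheory.Lp ℝ ⊤ m → BoundedContinuousFunction E ℝ)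
    (hTc : ∀ t : ℝ, 0 < t → ∀ f : MeasureTheory.Lp ℝ ⊤ m,
      (T t f : E → ℝ) =ᵐ[m] (Tc t f : E → ℝ))
    (hsf : ∀ t : ℝ, 0 < t →
      ∀ (fs : ℕ → MeasureTheory.Lp ℝ ⊤ m) (f : MeasureTheory.Lp ℝ ⊤ m),
        (∃ C : ℝ, ∀ n, ‖fs n‖ ≤ C) →
        (∀ᵐ x ∂m, Filter.Tendsto (fun n => (fs n : E → ℝ) x) Filter.atTop
          (nhds ((f : E → ℝ) x))) →
        ∀ x, Filter.Tendsto (fun n => Tc t (fs n) x) Filter.atTop (nhds (Tc t f x))) :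
    ∀ (ts : ℕ → ℝ) (t : ℝ), (∀ n, 0 < ts n) → 0 < t →
      Filter.Tendsto ts Filter.atTop (nhds t) →
      ∀ f : MeasureTheory.Lp ℝ ⊤ m, ∀ C : Set E, IsCompact C →
        TendstoUniformlyOn (fun n x => Tc (ts n) f x) (fun x => Tc t f x) Filter.atTop C := by
  have hopen : m.IsOpenPosMeasure := ⟨fun U hU ⟨x, hx⟩ => by
    obtain ⟨r, hr, hrU⟩ := Metric.isOpen_iff.1 hU x hx
    exact ((hfull x r hr).trans_le (measure_mono hrU)).ne'⟩
  have hrep : ∀ t, 0 < t → ∀ f, ∀ F : BoundedContinuousFunction E ℝ,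
      (T t f : E → ℝ) =ᵐ[m] F → Tc t f = F := fun t ht f F hF =>
    DFunLike.coe_injective <| ((Tc t f).continuous.ae_eq_iff_eq m F.continuous).1
      ((hTc t ht f).symm.trans hF)
  have hposc : ∀ t, 0 < t → ∀ f : Lp ℝ ⊤ m, (0 ≤ᵐ[m] (f : E → ℝ)) → ∀ x, 0 ≤ Tc t f x := by
    intro t ht f hf x
    have hd : Dense {y | 0 ≤ Tc t f y} := Measure.dense_of_ae (μ := m) <| by
      filter_upwards [hpos t ht f hf, hTc t ht f] with y h1 h2
      rwa [← h2]
    have hc : IsClosed {y | 0 ≤ Tc t f y} := isClosed_le continuous_const (Tc t f).continuous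
    exact (hc.closure_eq ▸ hd.closure_eq).ge (Set.mem_univ x)
  have hbound : ∀ t, 0 < t → ∀ f x, |Tc t f x| ≤ ‖f‖ := by
    intro t ht f x
    have hd : Dense {y | |Tc t f y| ≤ ‖f‖} := Measure.dense_of_ae (μ := m) <| by
      filter_upwards [ae_norm_le_norm_Linf (T t f), hTc t ht f] with y h1 h2
      rw [← h2]
      refine h1.trans (((T t).le_opNorm f).trans ?_)
      exact mul_le_of_le_one_left (norm_nonneg _) (hcontr t ht)
    have hc : IsClosed {y | |Tc t f y| ≤ ‖f‖} :=
      isClosed_le (Tc t f).continuous.abs continuous_const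
    exact (hc.closure_eq ▸ hd.closure_eq).ge (Set.mem_univ x)
  have hlin : ∀ t, 0 < t → ∃ S : Lp ℝ ⊤ m →ₗ[ℝ] BoundedContinuousFunction E ℝ,
      ∀ f, S f = Tc t f := fun t ht =>
    ⟨{ toFun := Tc t
       map_add' := fun f g => hrep t ht _ _ <| by
        rw [map_add]
        filter_upwards [Lp.coeFn_add (T t f) (T t g), hTc t ht f, hTc t ht g] with y h1 h2 h3
        rw [h1, Pi.add_apply, h2, h3]; rfl
       map_smul' := fun c f => hrep t ht _ _ <| by
        rw [map_smul]
        filter_upwards [Lp.coeFn_smul c (T t f), hTc t ht f] with y h1 h2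
        rw [h1, Pi.smul_apply, h2]; rfl }, fun _ => rfl⟩
  have hsgc : ∀ t s, 0 < t → 0 < s → ∀ f, Tc (t + s) f = Tc t (T s f) :=
    fun t s ht hs f => hrep _ (add_pos ht hs) _ _ <| by
      rw [hsg t s ht hs]
      exact hTc t ht (T s f)
  have hptw : ∀ (f : Lp ℝ ⊤ m) (x : E) (t : ℝ), 0 < t → ContinuousAt (fun s => Tc s f x) t := by
    intro f x t ht
    have hdens : ∀ s, ∃ v : Lp ℝ 1 m, 0 < s → ∀ f, pairingLinfL1 m f v = Tc s f x := by
      intro s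
      by_cases hs : 0 < s
      · obtain ⟨S, hS⟩ := hlin s hs
        let φ : Lp ℝ ⊤ m →ₗ[ℝ] ℝ :=
          { toFun := fun f => S f x
            map_add' := fun f g => by simp
            map_smul' := fun c f => by simp }
        obtain ⟨g, hg, hφ⟩ := exists_integrable_density_of_bounded_ae_continuous φ
          fun fs f hC hlim => by
            simpa only [φ, LinearMap.coe_mk, AddHom.coe_mk, hS] using hsf s hs fs f hC hlim x
        refine ⟨hg.toL1 g, fun _ f => ?_⟩
        rw [← hS, show S f x = φ f from rfl, hφ, pairingLinfL1_apply]
        refine integral_congr_ae ?_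
        filter_upwards [hg.coeFn_toL1] with y hy
        rw [hy]
      · exact ⟨0, fun h => absurd h hs⟩
    choose v hv using hdens
    have hvc : ContinuousAt v t := by
      refine continuousAt_density_of_semigroup (T := T) (M := 1) (fun f g => ?_) hcontr
        (fun s hs => ?_) (fun a s ha hs f => ?_) ht
      · simp only [pairingLinfL1_apply]
        exact hmeas f g
      · obtain ⟨f, hf, hfv⟩ := exists_pairingLinfL1_eq_norm (v s)
        rw [← hfv, hv s hs]
        exact (le_abs_self _).trans ((hbound s hs f x).trans hf)
      · rw [hv _ (add_pos ha hs), hv a ha, hsgc a s ha hs]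
    refine (((pairingLinfL1 m f).continuous.continuousAt).comp hvc).congr ?_
    filter_upwards [lt_mem_nhds ht] with s hs using hv s hs f
  intro ts t _ ht hts f K hK
  have ht2 : 0 < t / 2 := half_pos ht
  let s : ℕ → ℝ := fun n => max (ts n - t / 2) (t / 4)
  have hs : ∀ n, 0 < s n := fun n => lt_of_lt_of_le (by positivity) (le_max_right _ _)
  have hslim : Tendsto s atTop (𝓝 (t / 2)) := by
    have := (hts.sub_const (t / 2)).max (tendsto_const_nhds (x := t / 4))
    rwa [sub_half, max_eq_left (by linarith)] at this
  obtain ⟨S, hS⟩ := hlin (t / 2) ht2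
  have key := tendstoUniformlyOn_of_positive_strongFeller (μ := m) S
    (fun f hf x => by rw [hS]; exact hposc _ ht2 f hf x)
    (fun fs f hC hlim x => by simpa only [hS] using hsf _ ht2 fs f hC hlim x)
    (F := fun n => T (s n) f - T (t / 2) f) (G := fun n x => Tc (s n) f x - Tc (t / 2) f x)
    (fun n => by
      filter_upwards [Lp.coeFn_sub (T (s n) f) (T (t / 2) f), hTc _ (hs n) f, hTc _ ht2 f]
        with y h1 h2 h3
      rw [h1, Pi.sub_apply, h2, h3])
    (fun n => ((Tc (s n) f).continuous.sub (Tc (t / 2) f).continuous).measurable)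
    (C := ‖f‖ + ‖f‖)
    (fun n x => (abs_sub _ _).trans (add_le_add (hbound _ (hs n) f x) (hbound _ ht2 f x)))
    (fun x => by
      have := ((hptw f x _ ht2).tendsto.comp hslim).sub_const (Tc (t / 2) f x)
      rwa [sub_self] at this) hK
  rw [Metric.tendstoUniformlyOn_iff] at key ⊢
  intro ε hε
  filter_upwards [key ε hε, hts.eventually (lt_mem_nhds (show 3 * t / 4 < t by linarith))]
    with n hn htn x hx
  have hsn : s n = ts n - t / 2 := max_eq_left (by linarith)
  have h1 : Tc (ts n) f = Tc (t / 2) (T (s n) f) := by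
    rw [← hsgc _ _ ht2 (hs n), hsn, add_sub_cancel]
  have h2 : Tc t f = Tc (t / 2) (T (t / 2) f) := by
    rw [← hsgc _ _ ht2 ht2, add_halves]
  have := hn x hx
  rw [map_sub, hS, hS, ← h1, ← h2, dist_zero_left] at this
  rwa [dist_comm, dist_eq_norm]
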